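/- Let μ be a Borel probability measure on [0,1]^d, let β > 0, C > 0, and set F = H^β(ℝ^d, ℝ, C). For every d⋆ > d*_β(μ), the β-upper Wasserstein dimension of μ, there exist n₀ ∈ ℕ and a constant K > 0 (possibly depending on μ, d⋆, β, C and d) such that for all n ≥ n₀, E ‖μ̂_n − μ‖_F ≤ K n^{-β/d⋆}. -/

import Mathlib

open Filter Topology MeasureTheory Set
open scoped ENNReal NNReal

noncomputable section

/-- Minimal number of closed balls of radius `ε` needed to cover `S`. -/
def coverN {X : Type*} [PseudoMetricSpace X] (ε : ℝ) (S : Set X) : ℕ∞ :=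
  ⨅ (t : Finset X) (_ : S ⊆ ⋃ x ∈ t, Metric.closedBall x ε), (t.card : ℕ∞)

/-- The `(ε,τ)`-covering number of a measure `μ`. -/
def measCoverN {X : Type*} [PseudoMetricSpace X] [MeasurableSpace X]
    (μ : Measure X) (ε τ : ℝ) : ℕ∞ :=
  ⨅ (S : Set X) (_ : MeasurableSet S) (_ : ENNReal.ofReal (1 - τ) ≤ μ S), coverN ε S

/-- Extended logarithm `ℝ≥0∞ → EReal`. -/
def elog (x : ℝ≥0∞) : EReal :=
  if x = 0 then ⊥ else if x = ⊤ then ⊤ else ((Real.log x.toReal : ℝ) : EReal)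

/-- `log N / log (1/ε)` as an extended real. -/
def dimRatio (N : ℕ∞) (ε : ℝ) : EReal :=
  elog (N : ℝ≥0∞) * (((Real.log (1 / ε))⁻¹ : ℝ) : EReal)

/-- The `α`-entropic dimension of a measure. -/
def entropicDim {X : Type*} [PseudoMetricSpace X] [MeasurableSpace X]
    (μ : Measure X) (α : ℝ) : EReal :=
  limsup (fun ε : ℝ => dimRatio (measCoverN μ ε (ε ^ α)) ε) (𝓝[>] (0 : ℝ))

/-- The `α`-upper Wasserstein dimension of a measure. -/
def upperWDim {X : Type*} [PseudoMetricSpace X] [MeasurableSpace X]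
    (μ : Measure X) (α : ℝ) : EReal :=
  sInf {x : EReal | ∃ s : ℝ, x = (s : EReal) ∧ 2 * α < s ∧
    limsup (fun ε : ℝ => dimRatio (measCoverN μ ε (ε ^ (s * α / (s - 2 * α)))) ε)
      (𝓝[>] (0 : ℝ)) ≤ (s : EReal)}

/-- The lower Wasserstein dimension of a measure. -/
def lowerWDim {X : Type*} [PseudoMetricSpace X] [MeasurableSpace X]
    (μ : Measure X) : EReal :=
  limsup (fun τ : ℝ =>
    liminf (fun ε : ℝ => dimRatio (measCoverN μ ε τ) ε) (𝓝[>] (0 : ℝ))) (𝓝[>] (0 : ℝ))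

/-- The support of a measure: points all of whose neighbourhoods have positive mass. -/
def msupport {X : Type*} [PseudoMetricSpace X] [MeasurableSpace X] (μ : Measure X) : Set X :=
  {x | ∀ r : ℝ, 0 < r → 0 < μ (Metric.ball x r)}

/-- The upper Minkowski dimension of (the support of) a measure. -/
def minkowskiDim {X : Type*} [PseudoMetricSpace X] [MeasurableSpace X]
    (μ : Measure X) : EReal :=
  limsup (fun ε : ℝ => dimRatio (coverN ε (msupport μ)) ε) (𝓝[>] (0 : ℝ))

/-- The upper packing dimension of a measure. -/
def packingDim {X : Type*} [PseudoMetricSpace X] [MeasurableSpace X]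
    (μ : Measure X) : EReal :=
  essSup (fun x =>
    limsup (fun r : ℝ => elog (μ (Metric.closedBall x r)) * (((Real.log r)⁻¹ : ℝ) : EReal))
      (𝓝[>] (0 : ℝ))) μ

/-- The lower regularity dimension of a measure. -/
def lowerRegDim {X : Type*} [PseudoMetricSpace X] [MeasurableSpace X]
    (μ : Measure X) : EReal :=
  sSup {x : EReal | ∃ s : ℝ, x = (s : EReal) ∧ ∃ C : ℝ, 0 < C ∧
    ∀ x0 ∈ msupport μ, ∀ r R : ℝ, 0 < r → r < R →
      ENNReal.ofReal (C * (R / r) ^ s) ≤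
        μ (Metric.closedBall x0 R) / μ (Metric.closedBall x0 r)}

/-- Partial derivative in coordinate `i`. -/
def pderiv' {d : ℕ} (i : Fin d) (f : (Fin d → ℝ) → ℝ) : (Fin d → ℝ) → ℝ :=
  fun x => fderiv ℝ f x (Pi.single i 1)

/-- Multi-index partial derivative `∂^s f`. -/
def mpderiv {d : ℕ} (s : Fin d → ℕ) (f : (Fin d → ℝ) → ℝ) : (Fin d → ℝ) → ℝ :=
  (List.finRange d).foldr (fun i g => (pderiv' i)^[s i] g) f

/-- The `β`-Hölder norm of `f : ℝ^d → ℝ` (with `ℓ∞` distances), valued in `ℝ≥0∞`. -/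
def holderNorm {d : ℕ} (β : ℝ) (f : (Fin d → ℝ) → ℝ) : ℝ≥0∞ :=
  (∑' s : {s : Fin d → ℕ // ∑ i, s i ≤ ⌊β⌋₊}, ⨆ x : Fin d → ℝ, (‖mpderiv s.1 f x‖₊ : ℝ≥0∞)) +
  ∑' s : {s : Fin d → ℕ // ∑ i, s i = ⌊β⌋₊}, ⨆ (x : Fin d → ℝ) (y : Fin d → ℝ) (_ : x ≠ y),
      (‖mpderiv s.1 f x - mpderiv s.1 f y‖₊ : ℝ≥0∞) / (nndist x y : ℝ≥0∞) ^ (β - (⌊β⌋₊ : ℝ))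

/-- The class `H^β(ℝ^d, ℝ, C)` of `β`-Hölder functions with norm at most `C`. -/
def HolderClass (d : ℕ) (β C : ℝ) : Set ((Fin d → ℝ) → ℝ) :=
  {f | ContDiff ℝ (⌊β⌋₊ : ℕ) f ∧ holderNorm β f ≤ ENNReal.ofReal C}

/-- The integral probability metric `‖P - Q‖_F`. -/
def ipm {X : Type*} [MeasurableSpace X] (F : Set (X → ℝ)) (P Q : Measure X) : ℝ :=
  ⨆ f : F, |∫ x, f.1 x ∂P - ∫ x, f.1 x ∂Q|

/-- The empirical measure of a sample `x : Fin n → X`. -/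
def empMeas {X : Type*} [MeasurableSpace X] {n : ℕ} (x : Fin n → X) : Measure X :=
  (n : ℝ≥0∞)⁻¹ • ∑ i : Fin n, Measure.dirac (x i)

/-- Total variation distance between two measures. -/
def tvDist {X : Type*} [MeasurableSpace X] (P Q : Measure X) : ℝ :=
  ⨆ A : {A : Set X // MeasurableSet A}, |(P A.1).toReal - (Q A.1).toReal|

end

open Filter Topology MeasureTheory Set
open scoped ENNReal

section HolderDerivatives

variable {d : ℕ}

/-- Partial derivatives of a function of class `C^{k+1}` are of class `C^k`. -/
lemma contDiff_pderiv' {k : ℕ} {f : (Fin d → ℝ) → ℝ} (hf : ContDiff ℝ ((k + 1 : ℕ) : WithTop ℕ∞) f)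
    (i : Fin d) : ContDiff ℝ (k : WithTop ℕ∞) (pderiv' i f) := by
  unfold pderiv'
  have h : ContDiff ℝ (k : WithTop ℕ∞) (fderiv ℝ f) :=
    hf.fderiv_right (by push_cast; exact le_rfl)
  exact h.clm_apply contDiff_const

lemma contDiff_iterate_pderiv' {k : ℕ} (i : Fin d) (r : ℕ) {f : (Fin d → ℝ) → ℝ}
    (hf : ContDiff ℝ ((k + r : ℕ) : WithTop ℕ∞) f) :
    ContDiff ℝ (k : WithTop ℕ∞) ((pderiv' i)^[r] f) := by
  induction r generalizing f with
  | zero => simpa using hf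
  | succ r ih =>
    rw [Function.iterate_succ_apply]
    exact ih (contDiff_pderiv' (by rwa [add_assoc]) i)

/-- Partial derivatives of a `C²` function commute. -/
lemma pderiv'_comm {f : (Fin d → ℝ) → ℝ} (hf : ContDiff ℝ ((2 : ℕ) : WithTop ℕ∞) f)
    (i j : Fin d) : pderiv' i (pderiv' j f) = pderiv' j (pderiv' i f) := by
  funext x
  have hd : Differentiable ℝ (fderiv ℝ f) :=
    (hf.fderiv_right (m := 1) (by norm_num)).differentiable (by norm_num)
  have hs : IsSymmSndFDerivAt ℝ f x :=
    hf.contDiffAt.isSymmSndFDerivAt (by simp)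
  have key : ∀ a b : Fin d, pderiv' a (pderiv' b f) x
      = fderiv ℝ (fderiv ℝ f) x (Pi.single a 1) (Pi.single b 1) := by
    intro a b
    unfold pderiv'
    rw [fderiv_clm_apply (hd x) (differentiableAt_const _)]
    simp
  rw [key, key]
  exact hs _ _

lemma pderiv'_iterate_comm (i j : Fin d) (r : ℕ) {f : (Fin d → ℝ) → ℝ}
    (hf : ContDiff ℝ ((r + 1 : ℕ) : WithTop ℕ∞) f) :
    pderiv' i ((pderiv' j)^[r] f) = (pderiv' j)^[r] (pderiv' i f) := by
  induction r generalizing f with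
  | zero => rfl
  | succ r ih =>
    rw [Function.iterate_succ_apply, ih (contDiff_pderiv' hf j), pderiv'_comm (hf.of_le ?_) i j,
      Function.iterate_succ_apply]
    exact_mod_cast (by omega : 2 ≤ r + 1 + 1)

lemma contDiff_foldr_pderiv' (l : List (Fin d)) (s : Fin d → ℕ) {k : ℕ} {f : (Fin d → ℝ) → ℝ}
    (hf : ContDiff ℝ ((k + (l.map s).sum : ℕ) : WithTop ℕ∞) f) :
    ContDiff ℝ (k : WithTop ℕ∞) (l.foldr (fun i g => (pderiv' i)^[s i] g) f) := by
  induction l generalizing k with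
  | nil => simpa using hf
  | cons a l ih =>
    rw [List.foldr_cons]
    refine contDiff_iterate_pderiv' a (s a) (ih ?_)
    simpa [add_assoc] using hf

lemma pderiv'_foldr (l : List (Fin d)) (hl : l.Nodup) (s : Fin d → ℕ) (i : Fin d) (hi : i ∈ l)
    {f : (Fin d → ℝ) → ℝ} (hf : ContDiff ℝ ((1 + (l.map s).sum : ℕ) : WithTop ℕ∞) f) :
    pderiv' i (l.foldr (fun i g => (pderiv' i)^[s i] g) f)
      = l.foldr (fun j g => (pderiv' j)^[(s + Pi.single i 1 : Fin d → ℕ) j] g) f := by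
  induction l with
  | nil => simp at hi
  | cons a l ih =>
    rw [List.nodup_cons] at hl
    rw [List.foldr_cons, List.foldr_cons]
    by_cases hia : i = a
    · subst hia
      have hc : l.foldr (fun j g => (pderiv' j)^[(s + Pi.single i 1 : Fin d → ℕ) j] g) f
          = l.foldr (fun j g => (pderiv' j)^[s j] g) f := by
        refine List.foldr_ext _ _ _ fun j hj g => ?_
        have hji : j ≠ i := fun h => hl.1 (h ▸ hj)
        simp [hji]
      rw [hc]
      simp [Function.iterate_succ_apply', -Function.iterate_succ]
    · have hil : i ∈ l := by
        rcases List.mem_cons.1 hi with h | h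
        · exact absurd h hia
        · exact h
      have hai : a ≠ i := fun h => hia h.symm
      rw [pderiv'_iterate_comm, ih hl.2 hil]
      · simp [hai]
      · refine hf.of_le ?_
        rw [List.map_cons, List.sum_cons]
        exact_mod_cast (by omega)
      · refine contDiff_foldr_pderiv' l s ?_
        rw [List.map_cons, List.sum_cons] at hf
        refine hf.of_le ?_
        exact_mod_cast (by omega)

lemma contDiff_mpderiv (s : Fin d → ℕ) {k : ℕ} {f : (Fin d → ℝ) → ℝ}
    (hf : ContDiff ℝ ((k + ∑ i, s i : ℕ) : WithTop ℕ∞) f) :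
    ContDiff ℝ (k : WithTop ℕ∞) (mpderiv s f) :=
  contDiff_foldr_pderiv' _ s (by rwa [← Fin.sum_univ_def])

lemma pderiv'_mpderiv (s : Fin d → ℕ) (i : Fin d) {f : (Fin d → ℝ) → ℝ}
    (hf : ContDiff ℝ ((1 + ∑ i, s i : ℕ) : WithTop ℕ∞) f) :
    pderiv' i (mpderiv s f) = mpderiv (s + Pi.single i 1) f :=
  pderiv'_foldr _ (List.nodup_finRange d) s i (List.mem_finRange i)
    (by rwa [← Fin.sum_univ_def])

lemma mpderiv_zero (f : (Fin d → ℝ) → ℝ) : mpderiv 0 f = f := by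
  unfold mpderiv
  induction List.finRange d with
  | nil => rfl
  | cons a l ih => rw [List.foldr_cons, ih]; rfl

/-- `f` is differentiable `m` times along the coordinate directions, and all the partial
derivatives of order `m` are Hölder continuous with exponent `θ` and constant `C`. -/
def HolderDeriv (d : ℕ) (θ C : ℝ) : ℕ → ((Fin d → ℝ) → ℝ) → Prop
  | 0, f => ∀ x y, |f x - f y| ≤ C * ‖x - y‖ ^ θ
  | m + 1, f => Differentiable ℝ f ∧ ∀ i, HolderDeriv d θ C m (pderiv' i f)

lemma holderDeriv_mpderiv {θ C : ℝ} {m : ℕ} {f : (Fin d → ℝ) → ℝ}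
    (hf : ContDiff ℝ (m : WithTop ℕ∞) f)
    (hC : ∀ s : Fin d → ℕ, ∑ i, s i = m → ∀ x y,
      |mpderiv s f x - mpderiv s f y| ≤ C * ‖x - y‖ ^ θ)
    (k : ℕ) (s : Fin d → ℕ) (hs : ∑ i, s i + k = m) : HolderDeriv d θ C k (mpderiv s f) := by
  induction k generalizing s with
  | zero => exact hC s hs
  | succ k ih =>
    have h1 : ContDiff ℝ ((1 + ∑ i, s i : ℕ) : WithTop ℕ∞) f :=
      hf.of_le (by exact_mod_cast (by omega))
    refine ⟨(contDiff_mpderiv s h1).differentiable (by simp), fun i => ?_⟩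
    rw [pderiv'_mpderiv s i h1]
    refine ih _ ?_
    simp only [Pi.add_apply, Finset.sum_add_distrib, Finset.sum_pi_single', Finset.mem_univ, if_true]
    rw [← hs]
    omega

lemma holderNorm_bounds {β C : ℝ} (hC : 0 ≤ C) {f : (Fin d → ℝ) → ℝ}
    (hf : f ∈ HolderClass d β C) :
    (∀ x, |f x| ≤ C) ∧ ∀ s : Fin d → ℕ, ∑ i, s i = ⌊β⌋₊ → ∀ x y,
      |mpderiv s f x - mpderiv s f y| ≤ C * ‖x - y‖ ^ (β - ⌊β⌋₊) := by
  obtain ⟨-, hn⟩ := hf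
  unfold holderNorm at hn
  constructor
  · intro x
    have h1 := (le_self_add).trans hn
    have h2 := (ENNReal.le_tsum (⟨0, by simp⟩ : {s : Fin d → ℕ // ∑ i, s i ≤ ⌊β⌋₊})).trans h1
    have h3 := (le_iSup (fun x : Fin d → ℝ => (‖mpderiv 0 f x‖₊ : ℝ≥0∞)) x).trans h2
    rw [mpderiv_zero, ← enorm_eq_nnnorm, Real.enorm_eq_ofReal_abs] at h3
    exact (ENNReal.ofReal_le_ofReal_iff hC).1 h3
  · intro s hs x y
    rcases eq_or_ne x y with rfl | hxy
    · simp only [sub_self, abs_zero]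
      positivity
    have h1 := (le_add_self).trans hn
    have h2 := (ENNReal.le_tsum (⟨s, hs⟩ : {s : Fin d → ℕ // ∑ i, s i = ⌊β⌋₊})).trans h1
    have h3 : (‖mpderiv s f x - mpderiv s f y‖₊ : ℝ≥0∞)
        / (nndist x y : ℝ≥0∞) ^ (β - (⌊β⌋₊ : ℝ)) ≤ ENNReal.ofReal C := by
      refine le_trans ?_ h2
      exact le_iSup_of_le x (le_iSup_of_le y (le_iSup_of_le hxy le_rfl))
    have hpos : 0 < ‖x - y‖ := norm_pos_iff.2 (sub_ne_zero.2 hxy)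
    have hd : (nndist x y : ℝ≥0∞) = ENNReal.ofReal ‖x - y‖ := by
      rw [← edist_nndist, edist_dist, dist_eq_norm]
    rw [hd, ENNReal.ofReal_rpow_of_pos hpos, ← enorm_eq_nnnorm, Real.enorm_eq_ofReal_abs,
      ENNReal.div_le_iff (by simpa using Real.rpow_pos_of_pos hpos _) ENNReal.ofReal_ne_top,
      ← ENNReal.ofReal_mul hC, ENNReal.ofReal_le_ofReal_iff (by positivity)] at h3
    exact h3

lemma HolderClass.holderDeriv {β C : ℝ} (hC : 0 ≤ C) {f : (Fin d → ℝ) → ℝ}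
    (hf : f ∈ HolderClass d β C) : HolderDeriv d (β - ⌊β⌋₊) C ⌊β⌋₊ f := by
  have h := holderDeriv_mpderiv hf.1 (holderNorm_bounds hC hf).2 ⌊β⌋₊ 0 (by simp)
  rwa [mpderiv_zero] at h

end HolderDerivatives

section TaylorPolynomials

variable {d : ℕ}

/-- The linear operator on polynomials with `rayIntegral p v = ∫₀¹ p (t v) dt`. -/
noncomputable def rayIntegral (d : ℕ) : MvPolynomial (Fin d) ℝ →ₗ[ℝ] MvPolynomial (Fin d) ℝ :=
  (MvPolynomial.basisMonomials (Fin d) ℝ).constr ℝ fun k =>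
    MvPolynomial.monomial k (((∑ i, k i : ℕ) : ℝ) + 1)⁻¹

lemma rayIntegral_monomial (k : Fin d →₀ ℕ) (a : ℝ) :
    rayIntegral d (MvPolynomial.monomial k a)
      = MvPolynomial.monomial k (a * (((∑ i, k i : ℕ) : ℝ) + 1)⁻¹) := by
  have h : MvPolynomial.monomial k a = a • MvPolynomial.basisMonomials (Fin d) ℝ k := by
    simp [MvPolynomial.smul_monomial]
  rw [h, map_smul, rayIntegral, Module.Basis.constr_basis, MvPolynomial.smul_monomial, smul_eq_mul]

lemma totalDegree_rayIntegral_le {m : ℕ} {p : MvPolynomial (Fin d) ℝ} (hp : p.totalDegree ≤ m) :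
    (rayIntegral d p).totalDegree ≤ m := by
  rw [p.as_sum, map_sum]
  refine MvPolynomial.totalDegree_finsetSum_le fun k hk => ?_
  rw [rayIntegral_monomial]
  exact (MvPolynomial.totalDegree_monomial_le _ _).trans
    ((MvPolynomial.le_totalDegree hk).trans hp)

lemma hasDerivAt_rayIntegral (p : MvPolynomial (Fin d) ℝ) (v : Fin d → ℝ) (t : ℝ) :
    HasDerivAt (fun t : ℝ => t * MvPolynomial.eval (t • v) (rayIntegral d p))
      (MvPolynomial.eval (t • v) p) t := by
  induction p using MvPolynomial.induction_on' with
  | monomial k a =>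
    rw [rayIntegral_monomial]
    have hpow : ∀ s : ℝ, ∏ i, (s • v) i ^ k i = s ^ (∑ i, k i) * ∏ i, v i ^ k i := by
      intro s
      simp only [Pi.smul_apply, smul_eq_mul, mul_pow, Finset.prod_mul_distrib, Finset.prod_pow_eq_pow_sum]
    simp only [MvPolynomial.eval_monomial, Finsupp.prod_fintype _ _ (fun i => pow_zero _), hpow]
    have hne : (((∑ i, k i : ℕ) : ℝ) + 1) ≠ 0 := by positivity
    have h := (hasDerivAt_pow ((∑ i, k i) + 1) t).const_mul
      (a * (((∑ i, k i : ℕ) : ℝ) + 1)⁻¹ * ∏ i, v i ^ k i)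
    refine (h.congr_deriv ?_).congr_of_eventuallyEq (Eventually.of_forall fun s => ?_)
    · push_cast at hne ⊢
      field_simp
    · ring
  | add p q hp hq =>
    simp only [map_add, mul_add]
    exact hp.add hq

/-- A function whose derivatives of order `m` are `θ`-Hölder is approximated near every point by a
polynomial of degree at most `m`, up to an error of order `m + θ`. -/
lemma HolderDeriv.exists_polynomial {θ C : ℝ} (hθ : 0 ≤ θ) (hC : 0 ≤ C) {m : ℕ}
    {f : (Fin d → ℝ) → ℝ} (hf : HolderDeriv d θ C m f) (c : Fin d → ℝ) :
    ∃ p : MvPolynomial (Fin d) ℝ, p.totalDegree ≤ m ∧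
      ∀ v, |f (c + v) - MvPolynomial.eval v p| ≤ (d : ℝ) ^ m * C * ‖v‖ ^ (m + θ) := by
  induction m generalizing f with
  | zero =>
    refine ⟨MvPolynomial.C (f c), by simp, fun v => ?_⟩
    simpa using hf (c + v) c
  | succ m ih =>
    choose p hpd hp using fun i => ih (hf.2 i)
    refine ⟨MvPolynomial.C (f c) + ∑ i, MvPolynomial.X i * rayIntegral d (p i), ?_, fun v => ?_⟩
    · refine (MvPolynomial.totalDegree_add _ _).trans (max_le (by simp) ?_)
      refine MvPolynomial.totalDegree_finsetSum_le fun i _ => ?_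
      refine (MvPolynomial.totalDegree_mul _ _).trans ?_
      rw [MvPolynomial.totalDegree_X, add_comm]
      exact Nat.add_le_add_right (totalDegree_rayIntegral_le (hpd i)) 1
    · have hlin : ∀ x, fderiv ℝ f x v = ∑ i, v i * pderiv' i f x := by
        intro x
        conv_lhs => rw [pi_eq_sum_univ' v]
        simp [pderiv', map_sum]
      have hder : ∀ t : ℝ, HasDerivAt (fun t : ℝ => f (c + t • v)
          - (f c + ∑ i, v i * (t * MvPolynomial.eval (t • v) (rayIntegral d (p i)))))
          (∑ i, v i * (pderiv' i f (c + t • v) - MvPolynomial.eval (t • v) (p i))) t := by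
        intro t
        have h1 : HasDerivAt (fun t : ℝ => c + t • v) v t := by
          simpa using ((hasDerivAt_id t).smul_const v).const_add c
        have h2 := (hf.1 (c + t • v)).hasFDerivAt.comp_hasDerivAt t h1
        have h3 := HasDerivAt.fun_sum fun i (_ : i ∈ Finset.univ) =>
          (hasDerivAt_rayIntegral (p i) v t).const_mul (v i)
        refine (h2.sub (h3.const_add (f c))).congr_deriv ?_
        rw [hlin]
        simp only [mul_sub, Finset.sum_sub_distrib]
      have hbound : ∀ t ∈ Ico (0 : ℝ) 1,
          ‖∑ i, v i * (pderiv' i f (c + t • v) - MvPolynomial.eval (t • v) (p i))‖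
            ≤ (d : ℝ) ^ (m + 1) * C * ‖v‖ ^ ((m + 1 : ℕ) + θ) := by
        intro t ht
        refine (norm_sum_le _ _).trans ?_
        have hi : ∀ i ∈ (Finset.univ : Finset (Fin d)),
            ‖v i * (pderiv' i f (c + t • v) - MvPolynomial.eval (t • v) (p i))‖
              ≤ ‖v‖ * ((d : ℝ) ^ m * C * ‖v‖ ^ (m + θ)) := by
          intro i _
          rw [norm_mul]
          refine mul_le_mul (norm_le_pi_norm v i) ((hp i (t • v)).trans ?_) (norm_nonneg _)
            (norm_nonneg _)
          refine mul_le_mul_of_nonneg_left ?_ (by positivity)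
          refine Real.rpow_le_rpow (norm_nonneg _) ?_ (by positivity)
          rw [norm_smul, Real.norm_of_nonneg ht.1]
          exact mul_le_of_le_one_left (norm_nonneg _) ht.2.le
        refine (Finset.sum_le_sum hi).trans ?_
        rw [Finset.sum_const, Finset.card_univ, Fintype.card_fin, nsmul_eq_mul]
        have hr : ‖v‖ * ‖v‖ ^ (m + θ) = ‖v‖ ^ ((m + 1 : ℕ) + θ) := by
          push_cast
          rw [show (m : ℝ) + 1 + θ = (m + θ) + 1 by ring,
            Real.rpow_add_one' (norm_nonneg _) (by positivity)]
          ring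
        rw [← hr, pow_succ]
        exact le_of_eq (by ring)
      have h := norm_image_sub_le_of_norm_deriv_le_segment_01'
        (fun t _ => (hder t).hasDerivWithinAt) hbound
      simpa using h

end TaylorPolynomials

section PolynomialCoefficients

variable {d : ℕ}

/-- Polynomials of bounded degree are stable under affine substitutions. -/
lemma exists_polynomial_comp_affine {m : ℕ} {p : MvPolynomial (Fin d) ℝ} (hp : p.totalDegree ≤ m)
    (a : Fin d → ℝ) (b : ℝ) :
    ∃ q : MvPolynomial (Fin d) ℝ, q.totalDegree ≤ m ∧
      ∀ u, MvPolynomial.eval u q = MvPolynomial.eval (a + b • u) p := by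
  refine ⟨∑ k ∈ p.support, MvPolynomial.C (p.coeff k) *
    ∏ i, (MvPolynomial.C (a i) + MvPolynomial.C b * MvPolynomial.X i) ^ k i, ?_, fun u => ?_⟩
  · refine MvPolynomial.totalDegree_finsetSum_le fun k hk => ?_
    refine (MvPolynomial.totalDegree_mul _ _).trans ?_
    rw [MvPolynomial.totalDegree_C, zero_add]
    refine (MvPolynomial.totalDegree_finsetProd _ _).trans ?_
    refine le_trans (Finset.sum_le_sum (g := fun i => k i) fun i _ => ?_) ?_
    · refine (MvPolynomial.totalDegree_pow _ _).trans (mul_le_of_le_one_right (Nat.zero_le _) ?_)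
      refine (MvPolynomial.totalDegree_add _ _).trans (max_le (by simp) ?_)
      refine (MvPolynomial.totalDegree_mul _ _).trans ?_
      simp
    · have h := (MvPolynomial.le_totalDegree hk).trans hp
      rwa [Finsupp.sum_fintype _ _ (fun _ => rfl)] at h
  · rw [MvPolynomial.eval_eq' (a + b • u) p]
    simp [map_sum, map_prod]

/-- On polynomials of degree at most `m`, the coefficients are controlled by the supremum over
the unit cube. -/
lemma exists_coeff_bound (d m : ℕ) :
    ∃ A : ℝ, 0 < A ∧ ∀ p : MvPolynomial (Fin d) ℝ, p.totalDegree ≤ m → ∀ B : ℝ,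
      (∀ u : Fin d → ℝ, (∀ i, 0 ≤ u i ∧ u i < 1) → |MvPolynomial.eval u p| ≤ B) →
      ∃ a : (Fin d → Fin (m + 1)) → ℝ, (∀ k, |a k| ≤ A * B) ∧
        ∀ u, MvPolynomial.eval u p = ∑ k, a k * ∏ i, u i ^ (k i : ℕ) := by
  classical
  let e : (Fin d → Fin (m + 1)) → (Fin d →₀ ℕ) :=
    fun k => Finsupp.equivFunOnFinite.symm fun i => (k i : ℕ)
  have he : Function.Injective e := by
    intro k l h
    funext i
    have := DFunLike.congr_fun h i
    exact Fin.ext (by simpa [e] using this)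
  let Q : Set (Fin d → ℝ) := Set.pi univ fun _ => Icc (0 : ℝ) (1 / 2)
  have : CompactSpace Q := isCompact_iff_compactSpace.1 (isCompact_univ_pi fun _ => isCompact_Icc)
  let L : ((Fin d → Fin (m + 1)) → ℝ) →ₗ[ℝ] C(Q, ℝ) :=
    { toFun := fun a => ⟨fun u => ∑ k, a k * ∏ i, u.1 i ^ (k i : ℕ), by
        refine continuous_finsetSum _ fun k _ => continuous_const.mul ?_
        exact continuous_finsetProd _ fun i _ =>
          ((continuous_apply i).comp continuous_subtype_val).pow _⟩
      map_add' := fun a b => by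
        ext u
        simp [add_mul, Finset.sum_add_distrib]
      map_smul' := fun c a => by
        ext u
        simp [Finset.mul_sum, mul_assoc] }
  have hker : LinearMap.ker L = ⊥ := by
    refine LinearMap.ker_eq_bot'.2 fun a ha => ?_
    have hz : (∑ k, MvPolynomial.monomial (e k) (a k) : MvPolynomial (Fin d) ℝ) = 0 := by
      refine MvPolynomial.funext_set (fun _ => Icc (0 : ℝ) (1 / 2))
        (fun _ => Icc_infinite (by norm_num)) fun u hu => ?_
      have h := DFunLike.congr_fun ha (⟨u, hu⟩ : Q)
      simpa [L, e, MvPolynomial.eval_monomial, Finsupp.prod_fintype] using h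
    funext k
    have h := congrArg (MvPolynomial.coeff (e k)) hz
    simpa [MvPolynomial.coeff_sum, MvPolynomial.coeff_monomial, he.eq_iff] using h
  obtain ⟨K, hK, hL⟩ := LinearMap.exists_antilipschitzWith L hker
  refine ⟨K, by exact_mod_cast hK, fun p hp B hB => ⟨fun k => p.coeff (e k), ?_, ?_⟩⟩
  all_goals
    have heval : ∀ u, MvPolynomial.eval u p = ∑ k, p.coeff (e k) * ∏ i, u i ^ (k i : ℕ) := by
      intro u
      rw [MvPolynomial.eval_eq']
      have h1 : ∑ k, p.coeff (e k) * ∏ i, u i ^ (k i : ℕ)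
          = ∑ x ∈ Finset.univ.image e, p.coeff x * ∏ i, u i ^ x i := by
        rw [Finset.sum_image fun _ _ _ _ h => he h]
        simp [e]
      rw [h1]
      refine Finset.sum_subset (fun x hx => ?_) fun x _ hx => ?_
      · have hdeg := (MvPolynomial.le_totalDegree hx).trans hp
        rw [Finsupp.sum_fintype _ _ (fun _ => rfl)] at hdeg
        refine Finset.mem_image.2 ⟨fun i => ⟨x i, ?_⟩, Finset.mem_univ _, ?_⟩
        · have := Finset.single_le_sum (f := fun i => x i) (fun _ _ => Nat.zero_le _)
            (Finset.mem_univ i)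
          omega
        · ext i
          simp [e]
      · rw [MvPolynomial.notMem_support_iff.1 hx, zero_mul]
  · intro k
    have hB0 : 0 ≤ B := (abs_nonneg _).trans (hB 0 fun _ => by simp)
    have h1 : ‖L fun k => p.coeff (e k)‖ ≤ B := by
      refine (ContinuousMap.norm_le _ hB0).2 fun u => ?_
      have h2 := hB u.1 fun i => ⟨(u.2 i trivial).1, (u.2 i trivial).2.trans_lt (by norm_num)⟩
      rw [heval] at h2
      exact h2
    have h3 := hL.le_mul_dist (fun k => p.coeff (e k)) 0
    rw [map_zero, dist_zero_right, dist_zero_right] at h3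
    exact (norm_le_pi_norm (fun k => p.coeff (e k)) k).trans
      (h3.trans (mul_le_mul_of_nonneg_left h1 K.2))
  · exact heval

end PolynomialCoefficients

section DyadicCells

variable {d : ℕ}

/-- The index of the half-open dyadic cell of side `2^{-j}` containing `x`. -/
noncomputable def cellIdx (j : ℕ) (x : Fin d → ℝ) : Fin d → ℤ := fun i => ⌊(2 : ℝ) ^ j * x i⌋

/-- The coordinates of `x` relative to its dyadic cell of side `2^{-j}`. -/
noncomputable def cellFract (j : ℕ) (x : Fin d → ℝ) : Fin d → ℝ := fun i => Int.fract ((2 : ℝ) ^ j * x i)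

/-- The point with relative coordinates `u` in the dyadic cell of side `2^{-j}` and index `q`. -/
noncomputable def cellPt (j : ℕ) (q : Fin d → ℤ) (u : Fin d → ℝ) : Fin d → ℝ :=
  fun i => ((2 : ℝ) ^ j)⁻¹ * (q i + u i)

lemma cellPt_cellIdx_cellFract (j : ℕ) (x : Fin d → ℝ) :
    cellPt j (cellIdx j x) (cellFract j x) = x := by
  funext i
  simp only [cellPt, cellIdx, cellFract, Int.floor_add_fract]
  field_simp

lemma cellIdx_cellPt (j : ℕ) (q : Fin d → ℤ) {u : Fin d → ℝ} (hu : ∀ i, 0 ≤ u i ∧ u i < 1) :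
    cellIdx j (cellPt j q u) = q := by
  funext i
  simp only [cellPt, cellIdx]
  rw [mul_inv_cancel_left₀ (by positivity), Int.floor_intCast_add, Int.floor_eq_zero_iff.2 (hu i),
    add_zero]

lemma cellIdx_succ_div_two (j : ℕ) (x : Fin d → ℝ) :
    (fun i => cellIdx (j + 1) x i / 2) = cellIdx j x := by
  funext i
  have h := Int.floor_div_natCast ((2 : ℝ) ^ (j + 1) * x i) 2
  simp only [cellIdx]
  push_cast at h
  rw [← h]
  congr 1
  ring

lemma norm_sub_corner_le (j : ℕ) (x : Fin d → ℝ) :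
    ‖x - cellPt j (cellIdx j x) 0‖ ≤ ((2 : ℝ) ^ j)⁻¹ := by
  refine (pi_norm_le_iff_of_nonneg (by positivity)).2 fun i => ?_
  have h : (x - cellPt j (cellIdx j x) 0) i = ((2 : ℝ) ^ j)⁻¹ * cellFract j x i := by
    conv_lhs => rw [Pi.sub_apply, ← congrFun (cellPt_cellIdx_cellFract j x) i]
    simp only [cellPt, Pi.zero_apply]
    ring
  have hfr : 0 ≤ cellFract j x i := Int.fract_nonneg _
  rw [h, Real.norm_of_nonneg (by positivity)]
  exact mul_le_of_le_one_right (by positivity) (Int.fract_lt_one _).le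

/-- Multiscale decomposition of a Hölder class: every function of the class is, up to an error of
order `2^{-Jβ}`, a sum over the dyadic scales `j ≤ J` of piecewise polynomials with coefficients of
order `2^{-jβ}`. -/
lemma exists_multiscale_decomposition (d : ℕ) {β C : ℝ} (hβ : 0 < β) (hC : 0 < C) :
    ∃ A : ℝ, 0 < A ∧ ∀ f ∈ HolderClass d β C,
      ∃ a : ℕ → (Fin d → ℤ) → (Fin d → Fin (⌊β⌋₊ + 1)) → ℝ,
        (∀ j q k, |a j q k| ≤ A * ((2 : ℝ) ^ (-β)) ^ j) ∧
        ∀ J x, |f x - ∑ j ∈ Finset.range (J + 1), ∑ k,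
          a j (cellIdx j x) k * ∏ i, cellFract j x i ^ (k i : ℕ)| ≤ A * ((2 : ℝ) ^ (-β)) ^ J := by
  set m := ⌊β⌋₊ with hm
  set r : ℝ := (2 : ℝ) ^ (-β) with hr
  have hr0 : 0 < r := by positivity
  have hrj : ∀ j : ℕ, (((2 : ℝ) ^ j)⁻¹) ^ β = r ^ j := by
    intro j
    rw [hr, Real.inv_rpow (by positivity), ← Real.rpow_neg (by positivity), ← Real.rpow_natCast,
      ← Real.rpow_mul (by norm_num), ← Real.rpow_natCast, ← Real.rpow_mul (by norm_num), mul_comm]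
  obtain ⟨A₁, hA₁, hcoef⟩ := exists_coeff_bound d m
  set A₀ : ℝ := (d : ℝ) ^ m * C with hA₀
  have hA₀' : 0 ≤ A₀ := by positivity
  refine ⟨A₁ * (C + A₀ * (1 + r⁻¹)) + A₀, by positivity, fun f hf => ?_⟩
  choose P hPd hP using fun (j : ℕ) (q : Fin d → ℤ) =>
    HolderDeriv.exists_polynomial (sub_nonneg.2 (Nat.floor_le hβ.le)) hC.le
      (HolderClass.holderDeriv hC.le hf) (cellPt j q 0)
  let R : ℕ → (Fin d → ℤ) → (Fin d → ℝ) → ℝ :=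
    fun j q x => MvPolynomial.eval (x - cellPt j q 0) (P j q)
  have hR : ∀ j x, |f x - R j (cellIdx j x) x| ≤ A₀ * r ^ j := by
    intro j x
    have h := hP j (cellIdx j x) (x - cellPt j (cellIdx j x) 0)
    rw [add_sub_cancel, add_sub_cancel] at h
    refine h.trans (mul_le_mul_of_nonneg_left ?_ hA₀')
    rw [← hrj]
    exact Real.rpow_le_rpow (norm_nonneg _) (norm_sub_corner_le j x) hβ.le
  let D : ℕ → (Fin d → ℤ) → (Fin d → ℝ) → ℝ :=
    fun j q x => R j q x - if j = 0 then 0 else R (j - 1) (fun i => q i / 2) x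
  have hRpoly : ∀ (j l : ℕ) (q q' : Fin d → ℤ), ∃ p : MvPolynomial (Fin d) ℝ, p.totalDegree ≤ m ∧
      ∀ u, MvPolynomial.eval u p = R j q (cellPt l q' u) := by
    intro j l q q'
    obtain ⟨p, hp, hpe⟩ := exists_polynomial_comp_affine (hPd j q)
      (cellPt l q' 0 - cellPt j q 0) (((2 : ℝ) ^ l)⁻¹)
    refine ⟨p, hp, fun u => (hpe u).trans ?_⟩
    simp only [R]
    congr 2
    funext i
    simp only [cellPt, Pi.add_apply, Pi.sub_apply, Pi.smul_apply, Pi.zero_apply, smul_eq_mul]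
    ring
  have hDpoly : ∀ j q, ∃ p : MvPolynomial (Fin d) ℝ, p.totalDegree ≤ m ∧
      ∀ u, MvPolynomial.eval u p = D j q (cellPt j q u) := by
    intro j q
    obtain ⟨p₁, hp₁, he₁⟩ := hRpoly j j q q
    obtain ⟨p₂, hp₂, he₂⟩ := hRpoly (j - 1) j (fun i => q i / 2) q
    refine ⟨p₁ - if j = 0 then 0 else p₂, ?_, fun u => ?_⟩
    · refine (MvPolynomial.totalDegree_sub _ _).trans (max_le hp₁ ?_)
      split_ifs
      · simp
      · exact hp₂
    · simp only [D, map_sub, he₁]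
      split_ifs
      · simp
      · rw [he₂]
  have hDbound : ∀ j x, |D j (cellIdx j x) x| ≤ (C + A₀ * (1 + r⁻¹)) * r ^ j := by
    intro j x
    rcases j with _ | j
    · have h1 := hR 0 x
      have h2 := (holderNorm_bounds hC.le hf).1 x
      have h3 : 0 ≤ A₀ * r⁻¹ := by positivity
      simp only [D, if_true, sub_zero, pow_zero, mul_one] at h1 ⊢
      rw [abs_le] at *
      constructor <;> nlinarith
    · have h1 := hR (j + 1) x
      have h2 := hR j x
      simp only [D, Nat.add_sub_cancel, Nat.succ_ne_zero, if_false, cellIdx_succ_div_two]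
      have h3 : A₀ * (1 + r⁻¹) * r ^ (j + 1) = A₀ * r ^ (j + 1) + A₀ * r ^ j := by
        rw [pow_succ]
        field_simp
      have h4 : 0 ≤ C * r ^ (j + 1) := by positivity
      rw [add_mul, h3]
      rw [abs_le] at *
      constructor <;> linarith
  choose p hpd hpe using hDpoly
  choose a ha hae using fun j q => hcoef (p j q) (hpd j q) ((C + A₀ * (1 + r⁻¹)) * r ^ j)
    (fun u hu => by
      have h := hDbound j (cellPt j q u)
      rwa [cellIdx_cellPt j q hu, ← hpe] at h)
  refine ⟨a, fun j q k => (ha j q k).trans ?_, fun J x => ?_⟩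
  · rw [← mul_assoc]
    exact mul_le_mul_of_nonneg_right (le_add_of_nonneg_right hA₀') (by positivity)
  · have hsum : ∑ j ∈ Finset.range (J + 1), ∑ k,
        a j (cellIdx j x) k * ∏ i, cellFract j x i ^ (k i : ℕ) = R J (cellIdx J x) x := by
      have hterm : ∀ j, ∑ k, a j (cellIdx j x) k * ∏ i, cellFract j x i ^ (k i : ℕ)
          = D j (cellIdx j x) x := by
        intro j
        rw [← hae, hpe, cellPt_cellIdx_cellFract]
      simp only [hterm]
      induction J with
      | zero => simp [D]
      | succ J ih =>
        rw [Finset.sum_range_succ, ih]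
        simp [D, cellIdx_succ_div_two]
    rw [hsum]
    refine (hR J x).trans (mul_le_mul_of_nonneg_right (le_add_of_nonneg_left ?_) (by positivity))
    positivity

end DyadicCells

section EmpiricalDeviations

variable {X : Type*} [MeasurableSpace X] {μ : Measure X} [IsProbabilityMeasure μ]

/-- Deviation of the empirical mean of `ψ` over the sample `x` from its expectation. -/
noncomputable def empDev (μ : Measure X) {n : ℕ} (ψ : X → ℝ) (x : Fin n → X) : ℝ :=
  |(n : ℝ)⁻¹ * ∑ i, ψ (x i) - ∫ y, ψ y ∂μ|

variable {ψ : X → ℝ} {n : ℕ}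

lemma integrable_of_mem_Icc (hψ : Measurable ψ) (h0 : ∀ x, 0 ≤ ψ x) (h1 : ∀ x, ψ x ≤ 1) :
    Integrable ψ μ :=
  (integrable_const (1 : ℝ)).mono' hψ.aestronglyMeasurable
    (Eventually.of_forall fun x => by rw [Real.norm_of_nonneg (h0 x)]; exact h1 x)

lemma integrable_comp_eval_pi (hψ : Integrable ψ μ) (i : Fin n) :
    Integrable (fun x : Fin n → X => ψ (x i)) (Measure.pi fun _ => μ) :=
  (measurePreserving_eval (fun _ : Fin n => μ) i).integrable_comp_of_integrable hψ

lemma integral_comp_eval_pi (hψ : Integrable ψ μ) (i : Fin n) :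
    ∫ x : Fin n → X, ψ (x i) ∂(Measure.pi fun _ => μ) = ∫ y, ψ y ∂μ := by
  have h := measurePreserving_eval (fun _ : Fin n => μ) i
  conv_rhs => rw [← h.map_eq]
  rw [integral_map h.measurable.aemeasurable (by rw [h.map_eq]; exact hψ.aestronglyMeasurable)]

lemma integral_mean_pi (hn : 0 < n) (hψ : Integrable ψ μ) :
    ∫ x : Fin n → X, (n : ℝ)⁻¹ * ∑ i, ψ (x i) ∂(Measure.pi fun _ => μ) = ∫ y, ψ y ∂μ := by
  rw [integral_const_mul, integral_finsetSum _ fun i _ => integrable_comp_eval_pi hψ i]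
  simp only [integral_comp_eval_pi hψ]
  rw [Finset.sum_const, Finset.card_univ, Fintype.card_fin, nsmul_eq_mul,
    inv_mul_cancel_left₀ (by positivity)]

lemma integrable_mean_pi (hψ : Integrable ψ μ) :
    Integrable (fun x : Fin n → X => (n : ℝ)⁻¹ * ∑ i, ψ (x i)) (Measure.pi fun _ => μ) :=
  (integrable_finsetSum _ fun i _ => integrable_comp_eval_pi hψ i).const_mul _

lemma integrable_empDev (hψ : Integrable ψ μ) :
    Integrable (fun x : Fin n → X => empDev μ ψ x) (Measure.pi fun _ => μ) :=
  ((integrable_mean_pi hψ).sub (integrable_const _)).abs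

lemma integral_empDev_le_two_mul (hn : 0 < n) (hψ : Integrable ψ μ) (h0 : ∀ x, 0 ≤ ψ x) :
    ∫ x : Fin n → X, empDev μ ψ x ∂(Measure.pi fun _ => μ) ≤ 2 * ∫ y, ψ y ∂μ := by
  have hI : 0 ≤ ∫ y, ψ y ∂μ := integral_nonneg h0
  have h : ∀ x : Fin n → X, empDev μ ψ x ≤ (n : ℝ)⁻¹ * ∑ i, ψ (x i) + ∫ y, ψ y ∂μ := by
    intro x
    have h2 : 0 ≤ (n : ℝ)⁻¹ * ∑ i, ψ (x i) :=
      mul_nonneg (by positivity) (Finset.sum_nonneg fun i _ => h0 _)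
    rw [empDev, abs_le]
    constructor <;> linarith
  refine (integral_mono (integrable_empDev hψ)
    ((integrable_mean_pi hψ).add (integrable_const _)) h).trans ?_
  simp only [Pi.add_apply]
  rw [integral_add (integrable_mean_pi hψ) (integrable_const _), integral_mean_pi hn hψ]
  simp only [integral_const, probReal_univ, one_smul]
  linarith

lemma integral_empDev_le_sqrt (hn : 0 < n) (hψ : Measurable ψ) (h0 : ∀ x, 0 ≤ ψ x)
    (h1 : ∀ x, ψ x ≤ 1) :
    ∫ x : Fin n → X, empDev μ ψ x ∂(Measure.pi fun _ => μ) ≤ √((∫ y, ψ y ∂μ) / n) := by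
  have hi : Integrable ψ μ := integrable_of_mem_Icc hψ h0 h1
  have hL2 : MemLp ψ 2 μ := MemLp.of_bound hψ.aestronglyMeasurable 1
    (Eventually.of_forall fun x => by rw [Real.norm_of_nonneg (h0 x)]; exact h1 x)
  set P : Measure (Fin n → X) := Measure.pi fun _ => μ with hP
  set Y : (Fin n → X) → ℝ := fun x => (n : ℝ)⁻¹ * ∑ i, ψ (x i) with hY
  have hYL2 : MemLp Y 2 P := by
    have hi2 : ∀ i : Fin n, MemLp (fun x : Fin n → X => ψ (x i)) 2 P := fun i =>
      hL2.comp_measurePreserving (measurePreserving_eval (fun _ : Fin n => μ) i)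
    exact (memLp_finsetSum Finset.univ fun i _ => hi2 i).const_mul (n : ℝ)⁻¹
  have hvarψ : ProbabilityTheory.variance ψ μ ≤ ∫ y, ψ y ∂μ := by
    refine (ProbabilityTheory.variance_le_expectation_sq hψ.aestronglyMeasurable).trans ?_
    refine integral_mono hL2.integrable_sq hi fun x => ?_
    have := h0 x
    have := h1 x
    simp only [Pi.pow_apply]
    nlinarith
  have hvarY : ProbabilityTheory.variance Y P ≤ (∫ y, ψ y ∂μ) / n := by
    have h2 : ProbabilityTheory.variance (fun x : Fin n → X => ∑ i, ψ (x i)) P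
        = n * ProbabilityTheory.variance ψ μ := by
      have h3 := ProbabilityTheory.variance_sum_pi (μ := fun _ : Fin n => μ)
        (X := fun _ => ψ) (fun _ => hL2)
      rw [Finset.sum_const, Finset.card_univ, Fintype.card_fin, nsmul_eq_mul] at h3
      rw [← h3]
      congr 1
      funext x
      simp
    rw [hY, ProbabilityTheory.variance_const_mul, h2]
    have hn' : (0 : ℝ) < n := by exact_mod_cast hn
    rw [le_div_iff₀ hn']
    calc ((n : ℝ)⁻¹) ^ 2 * (n * ProbabilityTheory.variance ψ μ) * n
        = ProbabilityTheory.variance ψ μ := by field_simp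
      _ ≤ _ := hvarψ
  have hmean : ∫ x, Y x ∂P = ∫ y, ψ y ∂μ := integral_mean_pi hn hi
  have hdev : (fun x : Fin n → X => empDev μ ψ x) = fun x => |Y x - ∫ x, Y x ∂P| := by
    funext x
    rw [hmean, empDev]
  have hZ : MemLp (fun x => |Y x - ∫ x, Y x ∂P|) 2 P := (hYL2.sub (memLp_const _)).abs
  refine Real.le_sqrt_of_sq_le (le_trans ?_ hvarY)
  rw [hdev, ProbabilityTheory.variance_eq_integral hYL2.aestronglyMeasurable.aemeasurable]
  have h4 := ProbabilityTheory.variance_nonneg (fun x => |Y x - ∫ x, Y x ∂P|) P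
  rw [ProbabilityTheory.variance_eq_sub hZ] at h4
  simp only [Pi.pow_apply, sq_abs] at h4
  linarith

/-- Total deviation of functions `ψ q` carried by the cells `c = q` of a partition. The cells
meeting `S` contribute the square root of their number over `n`, the others at most twice the mass
of the complement of `S`. -/
lemma sum_integral_empDev_le {I : Type*} (c : X → I) (hc : ∀ q, MeasurableSet (c ⁻¹' {q}))
    (Z : Finset I) (ψ : I → X → ℝ) (hψ : ∀ q, Measurable (ψ q)) (h0 : ∀ q x, 0 ≤ ψ q x)
    (h1 : ∀ q x, ψ q x ≤ (c ⁻¹' {q}).indicator 1 x) {S : Set X} {τ : ℝ}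
    (hτ : μ.real Sᶜ ≤ τ) (G : Finset I)
    (hG : ∀ x ∈ S, c x ∈ Z → c x ∈ G) (hn : 0 < n) :
    ∑ q ∈ Z, ∫ x : Fin n → X, empDev μ (ψ q) x ∂(Measure.pi fun _ => μ)
      ≤ √(G.card / n) + 2 * τ := by
  classical
  have h1' : ∀ q x, ψ q x ≤ 1 := fun q x =>
    (h1 q x).trans (Set.indicator_le_self' (fun _ _ => zero_le_one) x)
  have hInt : ∀ q, ∫ y, ψ q y ∂μ ≤ μ.real (c ⁻¹' {q}) := by
    intro q
    rw [← integral_indicator_one (hc q)]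
    exact integral_mono (integrable_of_mem_Icc (hψ q) (h0 q) (h1' q))
      ((integrable_const (1 : ℝ)).indicator (hc q)) (h1 q)
  have hdisj : ∀ T : Finset I, (↑T : Set I).PairwiseDisjoint fun q => c ⁻¹' {q} := by
    intro T q _ q' _ hqq
    exact Disjoint.preimage _ (by simpa using hqq)
  have hmeas : ∀ T : Finset I, ∑ q ∈ T, μ.real (c ⁻¹' {q}) = μ.real (⋃ q ∈ T, c ⁻¹' {q}) :=
    fun T => (measureReal_biUnion_finset (hdisj T) fun q _ => hc q).symm
  have hn' : (0 : ℝ) < n := by exact_mod_cast hn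
  rw [← Finset.sum_inter_add_sum_sdiff Z G]
  refine add_le_add ?_ ?_
  · calc ∑ q ∈ Z ∩ G, ∫ x : Fin n → X, empDev μ (ψ q) x ∂(Measure.pi fun _ => μ)
        ≤ ∑ q ∈ Z ∩ G, √(1 / n) * √(μ.real (c ⁻¹' {q})) := by
          refine Finset.sum_le_sum fun q _ => ?_
          refine (integral_empDev_le_sqrt hn (hψ q) (h0 q) (h1' q)).trans ?_
          rw [← Real.sqrt_mul (by positivity), one_div, inv_mul_eq_div]
          exact Real.sqrt_le_sqrt (by gcongr; exact hInt q)
      _ ≤ √(∑ q ∈ Z ∩ G, 1 / (n : ℝ)) * √(∑ q ∈ Z ∩ G, μ.real (c ⁻¹' {q})) :=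
          Real.sum_sqrt_mul_sqrt_le _ (fun _ => by positivity) fun _ => measureReal_nonneg
      _ ≤ √(G.card / n) * 1 := by
          refine mul_le_mul ?_ ?_ (Real.sqrt_nonneg _) (Real.sqrt_nonneg _)
          · refine Real.sqrt_le_sqrt ?_
            rw [Finset.sum_const, nsmul_eq_mul, mul_one_div]
            have : (Z ∩ G).card ≤ G.card := Finset.card_le_card Finset.inter_subset_right
            gcongr
          · rw [hmeas, Real.sqrt_le_iff, one_pow]
            exact ⟨zero_le_one, measureReal_le_one⟩
      _ = _ := mul_one _
  · calc ∑ q ∈ Z \ G, ∫ x : Fin n → X, empDev μ (ψ q) x ∂(Measure.pi fun _ => μ)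
        ≤ ∑ q ∈ Z \ G, 2 * μ.real (c ⁻¹' {q}) := by
          refine Finset.sum_le_sum fun q _ => ?_
          refine (integral_empDev_le_two_mul hn
            (integrable_of_mem_Icc (hψ q) (h0 q) (h1' q)) (h0 q)).trans ?_
          have := hInt q
          linarith
      _ = 2 * μ.real (⋃ q ∈ Z \ G, c ⁻¹' {q}) := by rw [← Finset.mul_sum, hmeas]
      _ ≤ 2 * τ := by
          refine mul_le_mul_of_nonneg_left ((measureReal_mono ?_).trans hτ) (by norm_num)
          intro x hx hxS
          simp only [mem_iUnion, mem_preimage, mem_singleton_iff, exists_prop] at hx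
          obtain ⟨q, hq, rfl⟩ := hx
          rw [Finset.mem_sdiff] at hq
          exact hq.2 (hG x hxS hq.1)

end EmpiricalDeviations

section DeterministicBound

variable {d : ℕ}

lemma measurable_cellIdx (j : ℕ) : Measurable (cellIdx j : (Fin d → ℝ) → Fin d → ℤ) :=
  measurable_pi_lambda _ fun i => ((measurable_pi_apply i).const_mul _).floor

lemma measurable_cellFract (j : ℕ) : Measurable (cellFract j : (Fin d → ℝ) → Fin d → ℝ) :=
  measurable_pi_lambda _ fun i => measurable_fract.comp ((measurable_pi_apply i).const_mul _)

/-- The monomial with exponent `k` in the relative coordinates of the dyadic cell of side `2^{-j}`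
and index `q`, extended by zero outside of this cell. -/
noncomputable def cellMonomial (j : ℕ) (k : Fin d → ℕ) (q : Fin d → ℤ) : (Fin d → ℝ) → ℝ :=
  (cellIdx j ⁻¹' {q}).indicator fun x => ∏ i, cellFract j x i ^ k i

lemma measurableSet_cell (j : ℕ) (q : Fin d → ℤ) :
    MeasurableSet (cellIdx j ⁻¹' {q} : Set (Fin d → ℝ)) :=
  measurable_cellIdx j (measurableSet_singleton q)

lemma measurable_cellMonomial (j : ℕ) (k : Fin d → ℕ) (q : Fin d → ℤ) :
    Measurable (cellMonomial j k q) :=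
  (Finset.measurable_fun_prod _ fun i _ =>
    ((measurable_pi_apply i).comp (measurable_cellFract j)).pow_const _).indicator
      (measurableSet_cell j q)

lemma cellMonomial_nonneg (j : ℕ) (k : Fin d → ℕ) (q : Fin d → ℤ) (x : Fin d → ℝ) :
    0 ≤ cellMonomial j k q x :=
  Set.indicator_nonneg (fun _ _ => Finset.prod_nonneg fun _ _ => pow_nonneg (Int.fract_nonneg _) _) x

lemma cellMonomial_le (j : ℕ) (k : Fin d → ℕ) (q : Fin d → ℤ) (x : Fin d → ℝ) :
    cellMonomial j k q x ≤ (cellIdx j ⁻¹' {q}).indicator 1 x :=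
  Set.indicator_le_indicator (Finset.prod_le_one (fun _ _ => pow_nonneg (Int.fract_nonneg _) _)
    fun _ _ => pow_le_one₀ (Int.fract_nonneg _) (Int.fract_lt_one _).le)

lemma integrable_cellMonomial {μ : Measure (Fin d → ℝ)} [IsProbabilityMeasure μ] (j : ℕ)
    (k : Fin d → ℕ) (q : Fin d → ℤ) : Integrable (cellMonomial j k q) μ :=
  integrable_of_mem_Icc (measurable_cellMonomial j k q) (cellMonomial_nonneg j k q)
    fun x => (cellMonomial_le j k q x).trans (Set.indicator_le_self' (fun _ _ => zero_le_one) x)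

/-- The indices of the dyadic cells of side `2^{-j}` meeting the unit cube. -/
noncomputable def cubeCells (d j : ℕ) : Finset (Fin d → ℤ) := Fintype.piFinset fun _ => Finset.Icc 0 (2 ^ j)

lemma cellIdx_mem_cubeCells (j : ℕ) {x : Fin d → ℝ} (hx : x ∈ Icc (0 : Fin d → ℝ) 1) :
    cellIdx j x ∈ cubeCells d j := by
  refine Fintype.mem_piFinset.2 fun i => Finset.mem_Icc.2 ⟨?_, ?_⟩
  · exact Int.floor_nonneg.2 (mul_nonneg (by positivity) (hx.1 i))
  · have h : (2 : ℝ) ^ j * x i ≤ 2 ^ j := mul_le_of_le_one_right (by positivity) (hx.2 i)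
    refine (Int.cast_le (R := ℝ)).1 ((Int.floor_le _).trans (h.trans_eq ?_))
    push_cast
    rfl

lemma sum_cubeCells (j : ℕ) (k : Fin d → ℕ) (a : (Fin d → ℤ) → ℝ) {x : Fin d → ℝ}
    (hx : x ∈ Icc (0 : Fin d → ℝ) 1) :
    ∑ q ∈ cubeCells d j, a q * cellMonomial j k q x
      = a (cellIdx j x) * ∏ i, cellFract j x i ^ k i := by
  rw [Finset.sum_eq_single_of_mem _ (cellIdx_mem_cubeCells j hx)]
  · simp [cellMonomial]
  · intro q _ hq
    simp [cellMonomial, hq.symm]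

lemma integral_empMeas {X : Type*} [MeasurableSpace X] [MeasurableSingletonClass X] {n : ℕ}
    (x : Fin n → X) (f : X → ℝ) : ∫ y, f y ∂(empMeas x) = (n : ℝ)⁻¹ * ∑ i, f (x i) := by
  rw [empMeas, integral_smul_measure, integral_finsetSum_measure fun i _ => integrable_dirac (by simp)]
  simp

lemma abs_mean_sub_integral_sum_le {X : Type*} [MeasurableSpace X] {μ : Measure X} {ι : Type*}
    (T : Finset ι) (a : ι → ℝ) (ψ : ι → X → ℝ) (hψ : ∀ t, Integrable (ψ t) μ) {n : ℕ}
    (x : Fin n → X) :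
    |(n : ℝ)⁻¹ * ∑ i, ∑ t ∈ T, a t * ψ t (x i) - ∫ y, ∑ t ∈ T, a t * ψ t y ∂μ|
      ≤ ∑ t ∈ T, |a t| * empDev μ (ψ t) x := by
  have h : (n : ℝ)⁻¹ * ∑ i, ∑ t ∈ T, a t * ψ t (x i) - ∫ y, ∑ t ∈ T, a t * ψ t y ∂μ
      = ∑ t ∈ T, a t * ((n : ℝ)⁻¹ * ∑ i, ψ t (x i) - ∫ y, ψ t y ∂μ) := by
    rw [integral_finsetSum _ fun t _ => (hψ t).const_mul _, Finset.sum_comm, Finset.mul_sum,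
      ← Finset.sum_sub_distrib]
    refine Finset.sum_congr rfl fun t _ => ?_
    rw [integral_const_mul, ← Finset.mul_sum]
    ring
  rw [h]
  refine (Finset.abs_sum_le_sum_abs _ _).trans_eq (Finset.sum_congr rfl fun t _ => ?_)
  rw [abs_mul, empDev]

lemma abs_mean_sub_integral_le {X : Type*} [MeasurableSpace X] {μ : Measure X}
    [IsProbabilityMeasure μ] {f g : X → ℝ} (hf : Integrable f μ) (hg : Integrable g μ) {B : ℝ}
    {Q : Set X} (hQ : ∀ᵐ y ∂μ, y ∈ Q) (hfg : ∀ y ∈ Q, |f y - g y| ≤ B) {n : ℕ} (hn : 0 < n)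
    (x : Fin n → X) (hx : ∀ i, x i ∈ Q) :
    |(n : ℝ)⁻¹ * ∑ i, f (x i) - ∫ y, f y ∂μ|
      ≤ |(n : ℝ)⁻¹ * ∑ i, g (x i) - ∫ y, g y ∂μ| + 2 * B := by
  have hn' : (0 : ℝ) < n := by exact_mod_cast hn
  have h1 : |(n : ℝ)⁻¹ * ∑ i, f (x i) - (n : ℝ)⁻¹ * ∑ i, g (x i)| ≤ B := by
    rw [← mul_sub, ← Finset.sum_sub_distrib, abs_mul, abs_of_pos (inv_pos.2 hn')]
    rw [inv_mul_le_iff₀ hn']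
    refine (Finset.abs_sum_le_sum_abs _ _).trans
      ((Finset.sum_le_sum fun i _ => hfg _ (hx i)).trans_eq ?_)
    simp
  have h2 : |∫ y, f y ∂μ - ∫ y, g y ∂μ| ≤ B := by
    rw [← integral_sub hf hg]
    have h := norm_integral_le_of_norm_le_const (μ := μ) (f := fun y => f y - g y) (C := B)
      (hQ.mono fun y hy => hfg y hy)
    simpa using h
  rw [abs_le] at h1 h2
  have h3 := le_abs_self ((n : ℝ)⁻¹ * ∑ i, g (x i) - ∫ y, g y ∂μ)
  have h4 := neg_abs_le ((n : ℝ)⁻¹ * ∑ i, g (x i) - ∫ y, g y ∂μ)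
  rw [abs_le]
  constructor <;> linarith [h1.1, h1.2, h2.1, h2.2]

/-- The integral probability metric between the empirical measure and `μ` over a Hölder class is
controlled by the deviations of finitely many monomials on dyadic cells. -/
lemma exists_ipm_empMeas_le (d : ℕ) {β C : ℝ} (hβ : 0 < β) (hC : 0 < C) :
    ∃ A : ℝ, 0 < A ∧ ∀ (μ : Measure (Fin d → ℝ)) [IsProbabilityMeasure μ],
      (∀ᵐ y ∂μ, y ∈ Icc (0 : Fin d → ℝ) 1) → ∀ (n J : ℕ), 0 < n → ∀ x : Fin n → Fin d → ℝ,
      (∀ i, x i ∈ Icc (0 : Fin d → ℝ) 1) →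
      ipm (HolderClass d β C) (empMeas x) μ ≤ A * (∑ j ∈ Finset.range (J + 1),
        ∑ k : Fin d → Fin (⌊β⌋₊ + 1), ∑ q ∈ cubeCells d j,
          ((2 : ℝ) ^ (-β)) ^ j * empDev μ (cellMonomial j (fun i => k i) q) x
          + ((2 : ℝ) ^ (-β)) ^ J) := by
  obtain ⟨A, hA, h⟩ := exists_multiscale_decomposition d hβ hC
  refine ⟨2 * A, by positivity, fun μ _ hμ n J hn x hx => ?_⟩
  have hr : 0 < (2 : ℝ) ^ (-β) := by positivity
  set r := (2 : ℝ) ^ (-β)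
  have hdev : ∀ ψ : (Fin d → ℝ) → ℝ, 0 ≤ empDev μ ψ x := fun _ => abs_nonneg _
  refine Real.iSup_le (fun f => ?_) ?_
  · obtain ⟨f, hf⟩ := f
    obtain ⟨a, ha, haf⟩ := h f hf
    let ι := Σ _ : ℕ, (Fin d → Fin (⌊β⌋₊ + 1)) × (Fin d → ℤ)
    let T : Finset ι := (Finset.range (J + 1)).sigma fun j => Finset.univ ×ˢ cubeCells d j
    let b : ι → ℝ := fun t => a t.1 t.2.2 t.2.1
    let ψ : ι → (Fin d → ℝ) → ℝ := fun t => cellMonomial t.1 (fun i => t.2.1 i) t.2.2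
    have hψ : ∀ t, Integrable (ψ t) μ := fun t => integrable_cellMonomial _ _ _
    have hfi : Integrable f μ := (integrable_const C).mono'
      hf.1.continuous.measurable.aestronglyMeasurable
      (Eventually.of_forall fun y => (holderNorm_bounds hC.le hf).1 y)
    have hgi : Integrable (fun y => ∑ t ∈ T, b t * ψ t y) μ :=
      integrable_finsetSum _ fun t _ => (hψ t).const_mul _
    have hfg : ∀ y ∈ Icc (0 : Fin d → ℝ) 1, |f y - ∑ t ∈ T, b t * ψ t y| ≤ A * r ^ J := by
      intro y hy
      have h1 := haf J y
      rw [Finset.sum_sigma]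
      simp only [Finset.sum_product, b, ψ]
      convert h1 using 5 with j _ k _
      exact sum_cubeCells j (fun i => k i) (fun q => a j q k) hy
    simp only [integral_empMeas]
    refine (abs_mean_sub_integral_le hfi hgi hμ hfg hn x hx).trans ?_
    have h2 := abs_mean_sub_integral_sum_le T b ψ hψ x
    have h3 : ∑ t ∈ T, |b t| * empDev μ (ψ t) x ≤ 2 * A * ∑ j ∈ Finset.range (J + 1),
        ∑ k : Fin d → Fin (⌊β⌋₊ + 1), ∑ q ∈ cubeCells d j,
          r ^ j * empDev μ (cellMonomial j (fun i => k i) q) x := by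
      rw [Finset.sum_sigma]
      simp only [Finset.sum_product, b, ψ, Finset.mul_sum]
      refine Finset.sum_le_sum fun j _ => Finset.sum_le_sum fun k _ =>
        Finset.sum_le_sum fun q _ => ?_
      rw [← mul_assoc]
      refine mul_le_mul_of_nonneg_right ((ha j q k).trans ?_) (hdev _)
      have : 0 ≤ A * r ^ j := by positivity
      linarith
    linarith
  · refine mul_nonneg (by positivity) (add_nonneg (Finset.sum_nonneg fun j _ =>
      Finset.sum_nonneg fun k _ => Finset.sum_nonneg fun q _ => ?_) (by positivity))
    exact mul_nonneg (by positivity) (hdev _)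

/-- Bound on the expected integral probability metric in terms of the number of dyadic cells
charged by sets of large measure. -/
lemma exists_integral_ipm_empMeas_le (d : ℕ) {β C : ℝ} (hβ : 0 < β) (hC : 0 < C) :
    ∃ A : ℝ, 0 < A ∧ ∀ (μ : Measure (Fin d → ℝ)) [IsProbabilityMeasure μ],
      (∀ᵐ y ∂μ, y ∈ Icc (0 : Fin d → ℝ) 1) → ∀ (n J : ℕ), 0 < n → ∀ b : ℕ → ℝ,
      (∀ j, ∃ (S : Set (Fin d → ℝ)) (G : Finset (Fin d → ℤ)), (∀ x ∈ S, cellIdx j x ∈ G) ∧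
        √(G.card / n) + 2 * μ.real Sᶜ ≤ b j) →
      ∫ x : Fin n → (Fin d → ℝ), ipm (HolderClass d β C) (empMeas x) μ ∂(Measure.pi fun _ => μ)
        ≤ A * (∑ j ∈ Finset.range (J + 1), ((2 : ℝ) ^ (-β)) ^ j * b j + ((2 : ℝ) ^ (-β)) ^ J) := by
  obtain ⟨A, hA, h⟩ := exists_ipm_empMeas_le d hβ hC
  set M : ℝ := ((Fintype.card (Fin d → Fin (⌊β⌋₊ + 1)) : ℕ) : ℝ) with hM
  have hM1 : 1 ≤ M := by
    rw [hM]
    exact_mod_cast Fintype.card_pos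
  refine ⟨A * M, by positivity, fun μ _ hμ n J hn b hb => ?_⟩
  have hr : 0 < (2 : ℝ) ^ (-β) := by positivity
  set r := (2 : ℝ) ^ (-β)
  have hae : ∀ᵐ x : Fin n → (Fin d → ℝ) ∂(Measure.pi fun _ => μ),
      ∀ i, x i ∈ Icc (0 : Fin d → ℝ) 1 :=
    ae_all_iff.2 fun i => (measurePreserving_eval (fun _ : Fin n => μ) i).quasiMeasurePreserving.ae hμ
  have hInt : ∀ (j : ℕ) (k : Fin d → Fin (⌊β⌋₊ + 1)) (q : Fin d → ℤ),
      Integrable (fun x : Fin n → (Fin d → ℝ) =>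
        r ^ j * empDev μ (cellMonomial j (fun i => k i) q) x) (Measure.pi fun _ => μ) :=
    fun j k q => (integrable_empDev (integrable_cellMonomial _ _ _)).const_mul _
  have hInt1 : ∀ (j : ℕ) (k : Fin d → Fin (⌊β⌋₊ + 1)), Integrable (fun x : Fin n → (Fin d → ℝ) => ∑ q ∈ cubeCells d j,
      r ^ j * empDev μ (cellMonomial j (fun i => k i) q) x)
      (Measure.pi fun _ => μ) :=
    fun j k => integrable_finsetSum _ fun q _ => hInt j k q
  have hInt2 : ∀ j, Integrable (fun x : Fin n → (Fin d → ℝ) =>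
      ∑ k : Fin d → Fin (⌊β⌋₊ + 1), ∑ q ∈ cubeCells d j,
        r ^ j * empDev μ (cellMonomial j (fun i => k i) q) x) (Measure.pi fun _ => μ) :=
    fun j => integrable_finsetSum _ fun k _ => hInt1 j k
  have hInt3 := integrable_finsetSum (Finset.range (J + 1)) fun j _ => hInt2 j
  refine (integral_mono_of_nonneg
    (Eventually.of_forall fun x => Real.iSup_nonneg fun f => abs_nonneg _)
    ((hInt3.add (integrable_const (r ^ J))).const_mul A)
    (hae.mono fun x hx => h μ hμ n J hn x hx)).trans ?_
  simp only [Pi.add_apply]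
  rw [integral_const_mul, integral_add hInt3 (integrable_const _),
    integral_finsetSum _ fun j _ => hInt2 j]
  simp only [integral_const, probReal_univ, one_smul]
  rw [mul_assoc]
  refine mul_le_mul_of_nonneg_left ?_ hA.le
  have hterm : ∀ j ∈ Finset.range (J + 1), ∫ x : Fin n → (Fin d → ℝ),
      ∑ k : Fin d → Fin (⌊β⌋₊ + 1), ∑ q ∈ cubeCells d j,
        r ^ j * empDev μ (cellMonomial j (fun i => k i) q) x ∂(Measure.pi fun _ => μ)
      ≤ M * (r ^ j * b j) := by
    intro j _
    rw [integral_finsetSum _ fun k _ => hInt1 j k]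
    have hk : ∀ k ∈ (Finset.univ : Finset (Fin d → Fin (⌊β⌋₊ + 1))),
        ∫ x : Fin n → (Fin d → ℝ), ∑ q ∈ cubeCells d j,
          r ^ j * empDev μ (cellMonomial j (fun i => k i) q) x ∂(Measure.pi fun _ => μ)
        ≤ r ^ j * b j := by
      intro k _
      rw [integral_finsetSum _ fun q _ => hInt j k q]
      simp only [integral_const_mul]
      rw [← Finset.mul_sum]
      refine mul_le_mul_of_nonneg_left ?_ (by positivity)
      obtain ⟨S, G, hSG, hbj⟩ := hb j
      exact (sum_integral_empDev_le (cellIdx j) (measurableSet_cell j) (cubeCells d j)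
        (fun q => cellMonomial j (fun i => k i) q) (fun q => measurable_cellMonomial _ _ _)
        (fun q => cellMonomial_nonneg _ _ _) (fun q => cellMonomial_le _ _ _) le_rfl G
        (fun x hx _ => hSG x hx) hn).trans hbj
    refine (Finset.sum_le_sum hk).trans_eq ?_
    rw [Finset.sum_const, Finset.card_univ, nsmul_eq_mul]
  rw [mul_add, Finset.mul_sum]
  exact add_le_add (Finset.sum_le_sum hterm) (le_mul_of_one_le_left (by positivity) hM1)

end DeterministicBound

section Covers

variable {d : ℕ}

/-- A set covered by `N` balls of radius `2^{-j}` meets at most `3^d N` dyadic cells of side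
`2^{-j}`. -/
lemma exists_cells_of_cover (j : ℕ) {η : ℝ} (hη : η ≤ ((2 : ℝ) ^ j)⁻¹) {S : Set (Fin d → ℝ)}
    (t : Finset (Fin d → ℝ)) (ht : S ⊆ ⋃ x ∈ t, Metric.closedBall x η) :
    ∃ G : Finset (Fin d → ℤ), (∀ x ∈ S, cellIdx j x ∈ G) ∧ G.card ≤ t.card * 3 ^ d := by
  classical
  refine ⟨t.biUnion fun c => Fintype.piFinset fun i =>
    Finset.Icc (cellIdx j c i - 1) (cellIdx j c i + 1), fun x hx => ?_, ?_⟩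
  · obtain ⟨c, hc, hxc⟩ := mem_iUnion₂.1 (ht hx)
    refine Finset.mem_biUnion.2 ⟨c, hc, Fintype.mem_piFinset.2 fun i => ?_⟩
    have h1 : |x i - c i| ≤ ((2 : ℝ) ^ j)⁻¹ := by
      have := (dist_le_pi_dist x c i).trans ((Metric.mem_closedBall.1 hxc).trans hη)
      rwa [Real.dist_eq] at this
    have h2 : |(2 : ℝ) ^ j * x i - 2 ^ j * c i| ≤ 1 := by
      rw [← mul_sub, abs_mul, abs_of_pos (by positivity)]
      calc (2 : ℝ) ^ j * |x i - c i| ≤ 2 ^ j * ((2 : ℝ) ^ j)⁻¹ := by gcongr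
        _ = 1 := mul_inv_cancel₀ (by positivity)
    rw [abs_le] at h2
    simp only [cellIdx, Finset.mem_Icc]
    constructor
    · rw [← Int.floor_sub_one]
      exact Int.floor_le_floor (by linarith)
    · rw [← Int.floor_add_one]
      exact Int.floor_le_floor (by linarith)
  · refine Finset.card_biUnion_le_card_mul _ _ _ fun c _ => ?_
    rw [Fintype.card_piFinset]
    refine (Finset.prod_le_pow_card _ _ 3 fun i _ => ?_).trans (by simp)
    rw [Int.card_Icc]
    omega

lemma exists_nat_of_dimRatio_lt {N : ℕ∞} {ε D : ℝ} (hε : 0 < ε) (hε1 : ε < 1)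
    (h : dimRatio N ε < (D : EReal)) : ∃ k : ℕ, N = k ∧ (k : ℝ) ≤ ε ^ (-D) := by
  have hlog : 0 < Real.log (1 / ε) := Real.log_pos (one_lt_one_div hε hε1)
  have hL : (0 : EReal) < (((Real.log (1 / ε))⁻¹ : ℝ) : EReal) := by
    exact_mod_cast inv_pos.2 hlog
  induction N using ENat.recTopCoe with
  | top =>
    exfalso
    have he : elog ((⊤ : ℕ∞) : ℝ≥0∞) = ⊤ := by simp [elog]
    rw [dimRatio, he, EReal.top_mul_of_pos hL] at h
    exact not_top_lt h
  | coe k =>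
    refine ⟨k, rfl, ?_⟩
    rcases Nat.eq_zero_or_pos k with rfl | hk
    · simpa using Real.rpow_nonneg hε.le _
    have hk' : (0 : ℝ) < k := by exact_mod_cast hk
    have he : elog (((k : ℕ∞) : ℝ≥0∞)) = ((Real.log k : ℝ) : EReal) := by
      simp [elog, hk.ne']
    rw [dimRatio, he, ← EReal.coe_mul, EReal.coe_lt_coe_iff, ← div_eq_mul_inv,
      div_lt_iff₀ hlog, one_div, Real.log_inv] at h
    rw [← Real.log_le_log_iff hk' (by positivity), Real.log_rpow hε]
    linarith

lemma exists_cover_of_measCoverN_eq {X : Type*} [PseudoMetricSpace X] [MeasurableSpace X]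
    {μ : Measure X} {ε τ : ℝ} {k : ℕ} (h : measCoverN μ ε τ = k) :
    ∃ (S : Set X) (t : Finset X), MeasurableSet S ∧ ENNReal.ofReal (1 - τ) ≤ μ S ∧
      S ⊆ ⋃ x ∈ t, Metric.closedBall x ε ∧ t.card ≤ k := by
  have h1 : measCoverN μ ε τ < ((k + 1 : ℕ) : ℕ∞) := by
    rw [h]
    exact_mod_cast Nat.lt_succ_self k
  unfold measCoverN coverN at h1
  simp only [iInf_lt_iff] at h1
  obtain ⟨S, hS, hμS, t, ht, htk⟩ := h1
  exact ⟨S, t, hS, hμS, ht, Nat.lt_succ_iff.1 (by exact_mod_cast htk)⟩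

/-- If the upper Wasserstein dimension is smaller than `D`, then at all small scales `ε` a set of
mass at least `1 - ε ^ (Dβ / (D - 2β))` can be covered by at most `ε ^ (-D)` balls. -/
lemma exists_covers_of_upperWDim_lt {X : Type*} [PseudoMetricSpace X] [MeasurableSpace X]
    {μ : Measure X} [IsProbabilityMeasure μ] {β D : ℝ}
    (h : upperWDim μ β < (D : EReal)) :
    2 * β < D ∧ ∃ ε₀ : ℝ, 0 < ε₀ ∧ ∀ ε : ℝ, 0 < ε → ε < ε₀ →
      ∃ (S : Set X) (t : Finset X), μ.real Sᶜ ≤ ε ^ (D * β / (D - 2 * β)) ∧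
        S ⊆ ⋃ x ∈ t, Metric.closedBall x ε ∧ (t.card : ℝ) ≤ ε ^ (-D) := by
  obtain ⟨-, ⟨s, rfl, hs, hlim⟩, hsD⟩ := sInf_lt_iff.1 h
  have hsD' : s < D := by exact_mod_cast hsD
  refine ⟨hs.trans hsD', ?_⟩
  have hev := Filter.eventually_lt_of_limsup_lt (hlim.trans_lt hsD)
  obtain ⟨ε₀, hε₀, hsub⟩ := mem_nhdsGT_iff_exists_Ioo_subset.1 hev
  refine ⟨min ε₀ 1, lt_min hε₀ one_pos, fun ε hε hε' => ?_⟩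
  have hε1 : ε < 1 := hε'.trans_le (min_le_right _ _)
  have hlt := hsub ⟨hε, hε'.trans_le (min_le_left _ _)⟩
  obtain ⟨k, hk, hkD⟩ := exists_nat_of_dimRatio_lt hε hε1 hlt
  obtain ⟨S, t, hS, hμS, ht, htk⟩ := exists_cover_of_measCoverN_eq hk
  refine ⟨S, t, ?_, ht, le_trans (by exact_mod_cast htk) hkD⟩
  rw [probReal_compl_eq_one_sub hS]
  have h1 : 1 - ε ^ (s * β / (s - 2 * β)) ≤ μ.real S := by
    rw [ENNReal.ofReal_le_iff_le_toReal (measure_ne_top μ S)] at hμS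
    exact hμS
  have h2 : ε ^ (s * β / (s - 2 * β)) ≤ ε ^ (D * β / (D - 2 * β)) := by
    refine Real.rpow_le_rpow_of_exponent_ge hε hε1.le ?_
    rw [div_le_div_iff₀ (by linarith) (by linarith)]
    nlinarith [mul_nonneg (sq_nonneg β) (sub_nonneg.2 hsD'.le)]
  linarith

end Covers

section Rates

/-- Summation over the dyadic scales `1, …, 2^{-J}` with `2^J` comparable to `w`. -/
lemma exists_sum_scales_le {β D : ℝ} (hβ : 0 < β) (hD : 2 * β < D) (M : ℝ) (hM : 0 < M) :
    ∃ K : ℝ, 0 < K ∧ ∀ (w : ℝ) (J : ℕ), 0 < w → (2 : ℝ) ^ J ≤ w → w < 2 ^ (J + 1) →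
      ∑ j ∈ Finset.range (J + 1), ((2 : ℝ) ^ (-β)) ^ j *
        (M * (w ^ (-β) + ((2 : ℝ) ^ j / w) ^ (D / 2))) + ((2 : ℝ) ^ (-β)) ^ J
        ≤ K * w ^ (-β) := by
  set r : ℝ := (2 : ℝ) ^ (-β) with hr
  set ρ : ℝ := (2 : ℝ) ^ (D / 2 - β) with hρ
  have hr0 : 0 < r := by positivity
  have hr1 : r < 1 := Real.rpow_lt_one_of_one_lt_of_neg (by norm_num) (by linarith)
  have hρ1 : 1 < ρ := Real.one_lt_rpow (by norm_num) (by linarith)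
  have h1r : 0 < 1 - r := by linarith
  have hρ1' : 0 < ρ - 1 := by linarith
  refine ⟨M * (1 - r)⁻¹ + M * (ρ / (ρ - 1)) + 2 ^ β, by positivity, fun w J hw hJ hJ' => ?_⟩
  have hpow : ∀ (e : ℝ) (j : ℕ), ((2 : ℝ) ^ e) ^ j = ((2 : ℝ) ^ j) ^ e := by
    intro e j
    rw [← Real.rpow_natCast, ← Real.rpow_mul (by norm_num), ← Real.rpow_natCast,
      ← Real.rpow_mul (by norm_num), mul_comm]
  have hgeom : ∑ j ∈ Finset.range (J + 1), r ^ j ≤ (1 - r)⁻¹ := by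
    rw [← tsum_geometric_of_lt_one hr0.le hr1]
    exact (summable_geometric_of_lt_one hr0.le hr1).sum_le_tsum _ fun j _ => by positivity
  have hgeom' : ∑ j ∈ Finset.range (J + 1), ρ ^ j ≤ ρ / (ρ - 1) * w ^ (D / 2 - β) := by
    rw [geom_sum_eq hρ1.ne']
    have h1 : ρ ^ J ≤ w ^ (D / 2 - β) := by
      rw [hρ, hpow]
      exact Real.rpow_le_rpow (by positivity) hJ (by linarith)
    rw [div_mul_eq_mul_div]
    refine div_le_div_of_nonneg_right ?_ hρ1'.le
    calc ρ ^ (J + 1) - 1 ≤ ρ * ρ ^ J := by rw [pow_succ]; linarith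
      _ ≤ _ := by gcongr
  have hterm : ∀ j : ℕ, r ^ j * (M * (w ^ (-β) + ((2 : ℝ) ^ j / w) ^ (D / 2)))
      = M * w ^ (-β) * r ^ j + M * w ^ (-(D / 2)) * ρ ^ j := by
    intro j
    have h1 : ρ ^ j = r ^ j * ((2 : ℝ) ^ j) ^ (D / 2) := by
      rw [hρ, hr, hpow, hpow, ← Real.rpow_add (by positivity)]
      congr 1
      ring
    rw [h1, Real.div_rpow (by positivity) hw.le, Real.rpow_neg hw.le (D / 2), div_eq_mul_inv]
    ring
  simp only [hterm]
  rw [Finset.sum_add_distrib, ← Finset.mul_sum, ← Finset.mul_sum]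
  have hlast : r ^ J ≤ 2 ^ β * w ^ (-β) := by
    rw [hr, hpow, Real.rpow_neg (by positivity), Real.rpow_neg hw.le, ← div_eq_mul_inv,
      ← Real.div_rpow (by norm_num) hw.le, ← Real.inv_rpow (by positivity)]
    refine Real.rpow_le_rpow (by positivity) ?_ hβ.le
    rw [inv_eq_one_div, div_le_div_iff₀ (by positivity) hw]
    rw [pow_succ] at hJ'
    linarith
  have hw1 : w ^ (-(D / 2)) * w ^ (D / 2 - β) = w ^ (-β) := by
    rw [← Real.rpow_add hw]
    congr 1
    ring
  calc _ ≤ M * w ^ (-β) * (1 - r)⁻¹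
        + M * w ^ (-(D / 2)) * (ρ / (ρ - 1) * w ^ (D / 2 - β)) + 2 ^ β * w ^ (-β) := by
        gcongr
    _ = M * w ^ (-β) * (1 - r)⁻¹
        + M * (ρ / (ρ - 1)) * (w ^ (-(D / 2)) * w ^ (D / 2 - β)) + 2 ^ β * w ^ (-β) := by ring
    _ = _ := by rw [hw1]; ring

/-- The covers provided by the dimension bound, at sample size `w ^ D` and scale `2^{-j}`. -/
lemma exists_cells_of_covers {d : ℕ} {μ : Measure (Fin d → ℝ)} {β D ε₀ : ℝ} (hβ : 0 < β)
    (hD : 2 * β < D)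
    (hcov : ∀ ε : ℝ, 0 < ε → ε < ε₀ → ∃ (S : Set (Fin d → ℝ)) (t : Finset (Fin d → ℝ)),
      μ.real Sᶜ ≤ ε ^ (D * β / (D - 2 * β)) ∧
        S ⊆ ⋃ x ∈ t, Metric.closedBall x ε ∧ (t.card : ℝ) ≤ ε ^ (-D))
    {w : ℝ} (hw : 0 < w) (hwε : w ^ (-((D - 2 * β) / D)) < ε₀) {n : ℕ} (hn : (n : ℝ) = w ^ D)
    (j : ℕ) :
    ∃ (S : Set (Fin d → ℝ)) (G : Finset (Fin d → ℤ)), (∀ x ∈ S, cellIdx j x ∈ G) ∧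
      √(G.card / n) + 2 * μ.real Sᶜ
        ≤ (3 ^ d + 2) * (w ^ (-β) + ((2 : ℝ) ^ j / w) ^ (D / 2)) := by
  have hD0 : 0 < D := by linarith
  have hD2 : 0 < D - 2 * β := by linarith
  set ε₁ : ℝ := w ^ (-((D - 2 * β) / D)) with hε₁
  have hε₁0 : 0 < ε₁ := by positivity
  set η : ℝ := min ((2 : ℝ) ^ j)⁻¹ ε₁ with hη
  have hη0 : 0 < η := lt_min (by positivity) hε₁0
  obtain ⟨S, t, hS, ht, htc⟩ := hcov η hη0 ((min_le_right _ _).trans_lt hwε)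
  obtain ⟨G, hSG, hG⟩ := exists_cells_of_cover j (min_le_left _ _) t ht
  refine ⟨S, G, hSG, ?_⟩
  have hτ : μ.real Sᶜ ≤ w ^ (-β) := by
    refine hS.trans ((Real.rpow_le_rpow hη0.le (min_le_right _ _) (by positivity)).trans_eq ?_)
    rw [hε₁, ← Real.rpow_mul hw.le]
    congr 1
    field_simp
  have hηD : η ^ (-D) ≤ w ^ (D - 2 * β) + ((2 : ℝ) ^ j) ^ D := by
    rcases min_choice ((2 : ℝ) ^ j)⁻¹ ε₁ with h | h
    · rw [hη, h, Real.rpow_neg (by positivity), Real.inv_rpow (by positivity), inv_inv]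
      exact le_add_of_nonneg_left (by positivity)
    · rw [hη, h, hε₁, ← Real.rpow_mul hw.le]
      refine le_trans (le_of_eq ?_) (le_add_of_nonneg_right (by positivity))
      congr 1
      field_simp
  have hGc : (G.card : ℝ) ≤ 3 ^ d * (w ^ (D - 2 * β) + ((2 : ℝ) ^ j) ^ D) := by
    calc (G.card : ℝ) ≤ t.card * 3 ^ d := by exact_mod_cast hG
      _ ≤ (w ^ (D - 2 * β) + ((2 : ℝ) ^ j) ^ D) * 3 ^ d := by
          gcongr
          exact htc.trans hηD
      _ = _ := mul_comm _ _
  set a : ℝ := w ^ (-β) with ha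
  set b : ℝ := ((2 : ℝ) ^ j / w) ^ (D / 2) with hb
  have ha0 : 0 ≤ a := by positivity
  have hb0 : 0 ≤ b := by positivity
  have ha2 : w ^ (D - 2 * β) / w ^ D = a ^ 2 := by
    rw [← Real.rpow_sub hw, ha, ← Real.rpow_mul_natCast hw.le]
    congr 1
    push_cast
    ring
  have hb2 : ((2 : ℝ) ^ j) ^ D / w ^ D = b ^ 2 := by
    rw [← Real.div_rpow (by positivity) hw.le, hb, ← Real.rpow_mul_natCast (by positivity)]
    congr 1
    push_cast
    ring
  have h3 : (1 : ℝ) ≤ 3 ^ d := one_le_pow₀ (by norm_num)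
  have hsqrt : √(G.card / n) ≤ 3 ^ d * (a + b) := by
    refine Real.sqrt_le_iff.2 ⟨by positivity, ?_⟩
    calc (G.card : ℝ) / n ≤ 3 ^ d * (w ^ (D - 2 * β) + ((2 : ℝ) ^ j) ^ D) / w ^ D := by
          rw [hn]
          gcongr
      _ = 3 ^ d * (a ^ 2 + b ^ 2) := by rw [← ha2, ← hb2]; ring
      _ ≤ 3 ^ d * 3 ^ d * (a + b) ^ 2 := by
          refine mul_le_mul (le_mul_of_one_le_left (by positivity) h3) ?_ (by positivity)
            (by positivity)
          nlinarith [mul_nonneg ha0 hb0]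
      _ = _ := by ring
  nlinarith

end Rates

/-- Let `μ` be a Borel probability measure on `[0,1]^d`, `β > 0`, `C > 0`
and `F = H^β(ℝ^d, ℝ, C)`.  For every `d⋆ > d*_β(μ)` there are `n₀ ∈ ℕ` and `K > 0` such
that for all `n ≥ n₀`, `E ‖μ̂_n − μ‖_F ≤ K n^{-β/d⋆}`, the expectation being over
`X₁, …, X_n` i.i.d. with law `μ` and `μ̂_n` the empirical measure. -/
theorem expected_empirical_holder_ipm_rate
    (d : ℕ) (μ : Measure (Fin d → ℝ)) [IsProbabilityMeasure μ]
    (hcube : μ (Set.Icc 0 1) = 1)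
    (β C : ℝ) (hβ : 0 < β) (hC : 0 < C)
    (dstar : ℝ) (hdstar : upperWDim μ β < (dstar : EReal)) :
    ∃ (n₀ : ℕ) (K : ℝ), 0 < K ∧ ∀ n : ℕ, n₀ ≤ n →
      (∫ x : Fin n → (Fin d → ℝ),
          ipm (HolderClass d β C) (empMeas x) μ ∂(Measure.pi fun _ => μ))
        ≤ K * (n : ℝ) ^ (-(β / dstar)) := by
  obtain ⟨hD, ε₀, hε₀, hcov⟩ := exists_covers_of_upperWDim_lt hdstar
  have hD0 : 0 < dstar := by linarith
  obtain ⟨A, hA, hbound⟩ := exists_integral_ipm_empMeas_le d hβ hC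
  obtain ⟨K, hK, hsum⟩ := exists_sum_scales_le hβ hD (3 ^ d + 2) (by positivity)
  have hae : ∀ᵐ y ∂μ, y ∈ Icc (0 : Fin d → ℝ) 1 :=
    (mem_ae_iff_prob_eq_one measurableSet_Icc).2 hcube
  have hlim : Tendsto (fun n : ℕ => ((n : ℝ) ^ (1 / dstar)) ^ (-((dstar - 2 * β) / dstar)))
      atTop (𝓝 0) :=
    (tendsto_rpow_neg_atTop (div_pos (by linarith) hD0)).comp
      ((tendsto_rpow_atTop (by positivity)).comp tendsto_natCast_atTop_atTop)
  obtain ⟨n₀, hn₀⟩ := eventually_atTop.1 (hlim.eventually_lt_const hε₀)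
  refine ⟨max n₀ 1, A * K, by positivity, fun n hn => ?_⟩
  have hn1 : 1 ≤ n := (le_max_right _ _).trans hn
  have hn1' : (1 : ℝ) ≤ n := by exact_mod_cast hn1
  set w : ℝ := (n : ℝ) ^ (1 / dstar) with hw
  have hw1 : 1 ≤ w := Real.one_le_rpow hn1' (by positivity)
  have hwD : (n : ℝ) = w ^ dstar := by
    rw [hw, ← Real.rpow_mul (by positivity), one_div_mul_cancel hD0.ne', Real.rpow_one]
  obtain ⟨J, hJ, hJ'⟩ := exists_nat_pow_near hw1 one_lt_two
  have hw0 : 0 < w := by linarith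
  refine (hbound μ hae n J hn1 _
    (exists_cells_of_covers hβ hD hcov hw0 (hn₀ n ((le_max_left _ _).trans hn)) hwD)).trans ?_
  have hrate : w ^ (-β) = (n : ℝ) ^ (-(β / dstar)) := by
    rw [hw, ← Real.rpow_mul (by positivity)]
    congr 1
    ring
  rw [mul_assoc, ← hrate]
  exact mul_le_mul_of_nonneg_left (hsum w J hw0 hJ hJ') hA.le
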